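/- For every ε > 0 there is a constant c(ε) > 0 such that for every real primitive Dirichlet character χ of fundamental discriminant d and every X ≥ 3, L(1 + 1/log X, χ) ≥ c(ε)|d|^{-ε}. -/

import Mathlib

/-- `d` is a fundamental discriminant: either `d ≡ 1 (mod 4)` and squarefree, or
`d = 4m` with `m` squarefree and `m ≡ 2, 3 (mod 4)`. -/
def IsFundamentalDiscriminant (d : ℤ) : Prop :=
  (Squarefree d ∧ d % 4 = 1) ∨
    (∃ m : ℤ, d = 4 * m ∧ Squarefree m ∧ (m % 4 = 2 ∨ m % 4 = 3))

section
open Complex Filter Topology MeasureTheory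

namespace Siegel

/-- Summatory function of a Dirichlet character. -/
noncomputable def charSum {N : ℕ} (χ : DirichletCharacter ℂ N) (t : ℝ) : ℂ :=
  ∑ k ∈ Finset.Icc 1 ⌊t⌋₊, χ (k : ZMod N)

lemma sum_range_period {N : ℕ} [NeZero N] (χ : DirichletCharacter ℂ N) (hχ : χ ≠ 1) :
    ∑ k ∈ Finset.range N, χ (k : ZMod N) = 0 := by
  rw [← χ.sum_eq_zero_of_ne_one hχ]
  refine Finset.sum_bij (fun k _ => (k : ZMod N)) (by simp) ?_ ?_ (by simp)
  · intro a ha b hb h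
    rw [Finset.mem_range] at ha hb
    have := congrArg ZMod.val h
    rwa [ZMod.val_cast_of_lt ha, ZMod.val_cast_of_lt hb] at this
  · intro b _
    exact ⟨b.val, Finset.mem_range.2 (ZMod.val_lt b), by simp⟩

lemma sum_range_add_period {N : ℕ} [NeZero N] (χ : DirichletCharacter ℂ N) (hχ : χ ≠ 1) (n : ℕ) :
    ∑ k ∈ Finset.range (n + N), χ (k : ZMod N) = ∑ k ∈ Finset.range n, χ (k : ZMod N) := by
  induction n with
  | zero => simpa using sum_range_period χ hχ
  | succ n ih =>
    rw [show n + 1 + N = (n + N) + 1 by ring, Finset.sum_range_succ, ih, Finset.sum_range_succ]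
    simp

lemma norm_sum_range_le {N : ℕ} [NeZero N] (χ : DirichletCharacter ℂ N) (hχ : χ ≠ 1) (n : ℕ) :
    ‖∑ k ∈ Finset.range n, χ (k : ZMod N)‖ ≤ N := by
  induction n using Nat.strong_induction_on with
  | _ n ih =>
    rcases lt_or_ge n N with h | h
    · refine (norm_sum_le _ _).trans ?_
      refine (Finset.sum_le_card_nsmul _ _ 1 (fun i _ => χ.norm_le_one _)).trans ?_
      simpa using h.le
    · obtain ⟨m, rfl⟩ := Nat.exists_eq_add_of_le' h
      rw [sum_range_add_period χ hχ]
      exact ih m (by have := NeZero.pos N; omega)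

lemma norm_charSum_le {N : ℕ} [NeZero N] (χ : DirichletCharacter ℂ N) (hχ : χ ≠ 1) (t : ℝ) :
    ‖charSum χ t‖ ≤ N := by
  have hN : N ≠ 1 := fun h => hχ (DirichletCharacter.level_one' χ h)
  have := norm_sum_range_le χ hχ (⌊t⌋₊ + 1)
  rw [Finset.range_eq_Ico, Finset.sum_eq_sum_Ico_succ_bot (by omega)] at this
  simp only [Nat.cast_zero, χ.map_zero' hN, zero_add] at this
  rw [charSum]
  convert this using 2
  refine Finset.sum_congr ?_ (fun _ _ => rfl)
  ext k; simp

lemma norm_charSum_le' {N : ℕ} (χ : DirichletCharacter ℂ N) (t : ℝ) (ht : 0 ≤ t) :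
    ‖charSum χ t‖ ≤ t := by
  refine (norm_sum_le _ _).trans ?_
  refine (Finset.sum_le_card_nsmul _ _ 1 (fun i _ => χ.norm_le_one _)).trans ?_
  simpa using Nat.floor_le ht

lemma charSum_eq_zero {N : ℕ} (χ : DirichletCharacter ℂ N) (t : ℝ) (ht : t < 1) :
    charSum χ t = 0 := by
  rw [charSum, Nat.floor_eq_zero.2 ht]; simp

lemma norm_charSum_interp {N : ℕ} [NeZero N] (χ : DirichletCharacter ℂ N) (hχ : χ ≠ 1)
    {η : ℝ} (h0 : 0 ≤ η) (h1 : η ≤ 1) (t : ℝ) (ht : 0 < t) :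
    ‖charSum χ t‖ ≤ (N : ℝ) ^ η * t ^ (1 - η) := by
  have h2 : ‖charSum χ t‖ = ‖charSum χ t‖ ^ η * ‖charSum χ t‖ ^ (1 - η) := by
    rcases (norm_nonneg (charSum χ t)).eq_or_lt with h | h
    · rw [← h]
      rcases h0.eq_or_lt with h' | h'
      · subst h'; simp
      · rw [Real.zero_rpow h'.ne']; simp
    · rw [← Real.rpow_add h]; simp
  rw [h2]
  refine mul_le_mul (Real.rpow_le_rpow (norm_nonneg _) ?_ h0)
    (Real.rpow_le_rpow (norm_nonneg _) ?_ ?_) (by positivity) (by positivity)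
  · exact norm_charSum_le χ hχ t
  · exact norm_charSum_le' χ t ht.le
  · linarith

lemma measurable_charSum {N : ℕ} (χ : DirichletCharacter ℂ N) : Measurable (charSum χ) := by
  unfold charSum
  exact (measurable_from_nat (f := fun n : ℕ => ∑ k ∈ Finset.Icc 1 n, χ (k : ZMod N))).comp
    Nat.measurable_floor

lemma LFunction_eq_integral {N : ℕ} [NeZero N] (χ : DirichletCharacter ℂ N) (hχ : χ ≠ 1)
    {s : ℂ} (hs : 0 < s.re) :
    DirichletCharacter.LFunction χ s =
      s * ∫ t in Set.Ioi (1 : ℝ), charSum χ t * (t : ℂ) ^ (-(s + 1)) := by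
  have key : ∀ s : ℂ, mellin (charSum χ) (-s) =
      ∫ t in Set.Ioi (1 : ℝ), charSum χ t * (t : ℂ) ^ (-(s + 1)) := by
    intro s
    rw [mellin, ← integral_Ici_eq_integral_Ioi (x := (1:ℝ))]
    symm
    rw [← setIntegral_eq_of_subset_of_forall_sdiff_eq_zero (t := Set.Ioi 0) measurableSet_Ioi (s := Set.Ici 1)
      (f := fun t : ℝ => charSum χ t * (t : ℂ) ^ (-(s + 1)))]
    · refine setIntegral_congr_fun (E := ℂ) measurableSet_Ioi fun (t : ℝ) _ => ?_
      simp only [smul_eq_mul]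
      rw [mul_comm]; congr 2; ring
    · intro t ht; exact Set.mem_Ioi.2 (lt_of_lt_of_le one_pos (Set.mem_Ici.1 ht))
    · intro t ht
      have : t < 1 := not_le.1 (fun h => ht.2 (Set.mem_Ici.2 h))
      simp [charSum_eq_zero χ t this]
  rw [← key]
  have hU : IsOpen {s : ℂ | 0 < s.re} := isOpen_lt continuous_const continuous_re
  have hloc : LocallyIntegrableOn (charSum χ) (Set.Ioi 0) := by
    refine LocallyIntegrable.locallyIntegrableOn ?_ _
    refine (locallyIntegrable_const (N : ℂ)).mono (measurable_charSum χ).aestronglyMeasurable ?_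
    refine Eventually.of_forall fun t => ?_
    simpa using norm_charSum_le χ hχ t
  have hd : DifferentiableOn ℂ (fun s => s * mellin (charSum χ) (-s)) {s : ℂ | 0 < s.re} := by
    intro s hs
    refine DifferentiableAt.differentiableWithinAt ?_
    refine differentiableAt_id.mul ?_
    have : DifferentiableAt ℂ (mellin (charSum χ)) (-s) := by
      refine mellin_differentiableAt_of_isBigO_rpow (a := 0) (b := -s.re - 1) hloc ?_ ?_ ?_ ?_
      · refine Asymptotics.IsBigO.of_bound N (Eventually.of_forall fun t => ?_)
        simpa using norm_charSum_le χ hχ t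
      · simpa using hs
      · refine Asymptotics.IsBigO.of_bound 1 ?_
        have : Set.Iio (1:ℝ) ∈ 𝓝[>] (0:ℝ) := mem_nhdsWithin_of_mem_nhds (Iio_mem_nhds one_pos)
        filter_upwards [this] with t ht
        rw [charSum_eq_zero χ t ht]; simp
      · simp
    exact this.comp s (differentiableAt_id.neg)
  have h1 := hd.analyticOnNhd hU
  have h2 := ((DirichletCharacter.differentiable_LFunction hχ).differentiableOn
    (s := {s : ℂ | 0 < s.re})).analyticOnNhd hU
  have hconn : IsPreconnected {s : ℂ | 0 < s.re} :=
    (convex_halfSpace_re_gt 0).isPreconnected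
  refine h2.eqOn_of_preconnected_of_eventuallyEq h1 hconn (z₀ := 2) (by simp) ?_ hs
  have : {s : ℂ | 1 < s.re} ∈ 𝓝 (2 : ℂ) :=
    (isOpen_lt continuous_const continuous_re).mem_nhds (by simp)
  filter_upwards [this] with z hz
  replace hz : 1 < z.re := hz
  rw [key, DirichletCharacter.LFunction_eq_LSeries χ hz]
  refine LSeries_eq_mul_integral (fun n => χ n) (r := 0) le_rfl (by linarith) ?_ ?_
  · exact DirichletCharacter.LSeriesSummable_of_one_lt_re χ hz
  · refine Asymptotics.IsBigO.of_bound N (Eventually.of_forall fun n => ?_)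
    have := norm_charSum_le χ hχ n
    simpa [charSum] using this

lemma norm_LFunction_le {N : ℕ} [NeZero N] (χ : DirichletCharacter ℂ N) (hχ : χ ≠ 1)
    {η : ℝ} (h0 : 0 ≤ η) (h1 : η ≤ 1) {s : ℂ} (hs : 0 < s.re) (hs' : 1 - η < s.re) :
    ‖DirichletCharacter.LFunction χ s‖ ≤ ‖s‖ * ((N : ℝ) ^ η / (s.re - 1 + η)) := by
  rw [LFunction_eq_integral χ hχ hs, norm_mul]
  gcongr
  have hlt : -(s.re + η) < -1 := by linarith
  have hintg : IntegrableOn (fun t : ℝ => (N : ℝ) ^ η * t ^ (-(s.re + η))) (Set.Ioi 1) :=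
    (integrableOn_Ioi_rpow_of_lt hlt one_pos).const_mul _
  refine (norm_integral_le_of_norm_le hintg ?_).trans ?_
  · refine (ae_restrict_iff' measurableSet_Ioi).2 (Eventually.of_forall fun t ht => ?_)
    have ht' : (0:ℝ) < t := lt_trans one_pos ht
    rw [norm_mul, norm_cpow_eq_rpow_re_of_pos ht']
    refine (mul_le_mul_of_nonneg_right (norm_charSum_interp χ hχ h0 h1 t ht')
      (by positivity)).trans (le_of_eq ?_)
    rw [mul_assoc, ← Real.rpow_add ht']
    congr 2
    simp; ring
  · rw [integral_const_mul, integral_Ioi_rpow_of_lt hlt one_pos]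
    simp only [Real.one_rpow]
    rw [div_eq_mul_inv]
    refine mul_le_mul_of_nonneg_left (le_of_eq ?_) (by positivity)
    rw [neg_one_mul, ← inv_neg]
    congr 1; ring

lemma real_char {N : ℕ} (χ : DirichletCharacter ℂ N) (hq : χ ^ 2 = 1) (a : ZMod N) :
    χ a = 0 ∨ χ a = 1 ∨ χ a = -1 := by
  by_cases ha : IsUnit a
  · right
    have : (χ ^ 2) a = 1 := by rw [hq, MulChar.one_apply ha]
    rw [MulChar.pow_apply' _ two_ne_zero] at this
    exact sq_eq_one_iff.1 this
  · left; exact χ.map_nonunit ha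

lemma LFunction_im {N : ℕ} [NeZero N] (χ : DirichletCharacter ℂ N) (hχ : χ ≠ 1) (hq : χ ^ 2 = 1)
    {x : ℝ} (hx : 0 < x) : (DirichletCharacter.LFunction χ x).im = 0 := by
  rw [LFunction_eq_integral χ hχ (by simpa using hx)]
  have hre : ∀ t, ((charSum χ t).re : ℂ) = charSum χ t := by
    intro t
    rw [charSum, re_sum, ofReal_sum]
    refine Finset.sum_congr rfl fun k _ => ?_
    rcases real_char χ hq k with h | h | h <;> simp [h]
  have : (∫ t in Set.Ioi (1 : ℝ), charSum χ t * (t : ℂ) ^ (-((x : ℂ) + 1))) =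
      ((∫ t in Set.Ioi (1 : ℝ), (charSum χ t).re * t ^ (-(x + 1)) : ℝ) : ℂ) := by
    refine Eq.trans ?_ (integral_ofReal (𝕜 := ℂ))
    refine setIntegral_congr_fun measurableSet_Ioi fun t ht => ?_
    have ht' : (0:ℝ) ≤ t := (lt_trans one_pos ht).le
    change charSum χ t * (t : ℂ) ^ (-((x : ℂ) + 1)) = Complex.ofReal ((charSum χ t).re * t ^ (-(x + 1)))
    push_cast
    rw [hre, ofReal_cpow ht']
    simp
  rw [this, ← ofReal_mul, ofReal_im]

open scoped ComplexOrder

/-- All derivatives at `2` alternate in sign. -/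
def Alt (f : ℂ → ℂ) : Prop := ∀ m : ℕ, 0 ≤ (-1) ^ m * iteratedDeriv m f 2

lemma estermann_aux (h : ℂ → ℂ) (hd : Differentiable ℂ h) (M : ℝ)
    (hM : ∀ s ∈ Metric.sphere (2 : ℂ) (4 / 3), ‖h s‖ ≤ M) (lam : ℂ) (b : ℕ → ℝ) (hb : ∀ m, 0 ≤ b m)
    (c1 : ℝ) (hb0 : c1 ≤ b 0)
    (hco : ∀ m : ℕ, (-1) ^ m * iteratedDeriv m h 2 / (m.factorial : ℂ) = b m - lam)
    (α : ℝ) (h9 : 9 / 10 ≤ α) (h1 : α < 1) (hneg : (h α + lam / (α - 1)).re ≤ 0) (N : ℕ)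
    (hN : 0 < N) :
    c1 - 6 * M * (5 / 6) ^ N ≤ lam.re * (2 - α) ^ N / (1 - α) := by
  have hM0 : 0 ≤ M := (norm_nonneg _).trans (hM (2 + ((4/3 : ℝ) : ℂ)) (by
    rw [mem_sphere_iff_norm, add_sub_cancel_left, norm_real]; norm_num))
  set w : ℝ := 2 - α with hw
  have hw1 : 1 < w := by linarith
  have hT := Complex.hasSum_taylorSeries_of_entire hd 2 (α : ℂ)
  have hterm : ∀ m : ℕ, ((m.factorial : ℂ))⁻¹ • ((α : ℂ) - 2) ^ m • iteratedDeriv m h 2 =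
      (b m - lam) * (w : ℂ) ^ m := by
    intro m
    rw [← hco m, hw, show (α : ℂ) - 2 = (-1) * ((2 - α : ℝ) : ℂ) by push_cast; ring, mul_pow]
    simp only [smul_eq_mul]
    ring
  simp_rw [hterm] at hT
  have hTr := hasSum_re hT
  have hre : ∀ m : ℕ, ((b m - lam) * (w : ℂ) ^ m).re = (b m - lam.re) * w ^ m := by
    intro m
    rw [← ofReal_pow, re_mul_ofReal]; simp
  simp_rw [hre] at hTr
  have hco' : ∀ m : ℕ, |b m - lam.re| ≤ M / (4 / 3) ^ m := by
    intro m
    have h2 := Complex.norm_iteratedDeriv_le_of_forall_mem_sphere_norm_le m (by norm_num)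
      (hd.diffContOnCl) hM
    have h3 : ‖(b m : ℂ) - lam‖ ≤ M / (4 / 3) ^ m := by
      rw [← hco m, norm_div, norm_mul, norm_pow, norm_neg, norm_one, one_pow, one_mul,
        norm_natCast, div_le_iff₀ (by positivity)]
      refine h2.trans (le_of_eq ?_)
      ring
    refine le_trans ?_ h3
    have := abs_re_le_norm ((b m : ℂ) - lam)
    simpa using this
  have hbd : ∀ m : ℕ, -(M * (5 / 6) ^ m) ≤ (b m - lam.re) * w ^ m := by
    intro m
    have : |(b m - lam.re) * w ^ m| ≤ M * (5 / 6) ^ m := by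
      rw [abs_mul, abs_of_nonneg (by positivity : 0 ≤ w ^ m)]
      calc |b m - lam.re| * w ^ m ≤ (M / (4 / 3) ^ m) * (11 / 10) ^ m := by
            have := hco' m
            have : w ≤ 11 / 10 := by linarith
            gcongr
        _ = M * (33 / 40) ^ m := by
            rw [show (33 / 40 : ℝ) = (11 / 10) / (4 / 3) by norm_num, div_pow (11 / 10 : ℝ)]
            field_simp
        _ ≤ M * (5 / 6) ^ m := by
            refine mul_le_mul_of_nonneg_left (pow_le_pow_left₀ (by norm_num) (by norm_num) _) hM0
    exact (abs_le.1 this).1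
  have hgeo : HasSum (fun i : ℕ => -(M * (5 / 6 : ℝ) ^ (i + N))) (-(6 * M * (5 / 6) ^ N)) := by
    have h5 := (hasSum_geometric_of_lt_one (r := 5 / 6) (by norm_num) (by norm_num)).mul_left
      (-(M * (5 / 6) ^ N))
    have e1 : (fun i : ℕ => -(M * (5 / 6 : ℝ) ^ (i + N))) =
        fun i : ℕ => -(M * (5 / 6 : ℝ) ^ N) * (5 / 6) ^ i := by
      funext i; rw [pow_add]; ring
    have e2 : -(6 * M * (5 / 6 : ℝ) ^ N) = -(M * (5 / 6) ^ N) * (1 - 5 / 6)⁻¹ := by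
      rw [show (1 - 5 / 6 : ℝ)⁻¹ = 6 by norm_num]; ring
    rw [e1, e2]; exact h5
  have hsplit := hTr.summable.sum_add_tsum_nat_add N
  rw [hTr.tsum_eq] at hsplit
  have htail : -(6 * M * (5 / 6) ^ N) ≤ ∑' i, (b (i + N) - lam.re) * w ^ (i + N) := by
    rw [← hgeo.tsum_eq]
    exact hgeo.summable.tsum_le_tsum (fun i => hbd (i + N))
      ((summable_nat_add_iff N).2 hTr.summable)
  have hhead : c1 - lam.re * ((w ^ N - 1) / (w - 1)) ≤
      ∑ i ∈ Finset.range N, (b i - lam.re) * w ^ i := by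
    have e : ∑ i ∈ Finset.range N, (b i - lam.re) * w ^ i =
        ∑ i ∈ Finset.range N, b i * w ^ i - lam.re * ∑ i ∈ Finset.range N, w ^ i := by
      rw [Finset.mul_sum, ← Finset.sum_sub_distrib]
      exact Finset.sum_congr rfl fun i _ => by ring
    rw [e, geom_sum_eq hw1.ne']
    have : b 0 * w ^ 0 ≤ ∑ i ∈ Finset.range N, b i * w ^ i :=
      Finset.single_le_sum (f := fun i => b i * w ^ i)
        (fun i _ => mul_nonneg (hb i) (by positivity)) (Finset.mem_range.2 hN)
    simp only [pow_zero, mul_one] at this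
    linarith
  have hfin : (h α).re + lam.re / (α - 1) ≤ 0 := by
    have e : lam / ((α : ℂ) - 1) = lam / ((α - 1 : ℝ) : ℂ) := by push_cast; ring
    rw [e, add_re, div_ofReal_re] at hneg
    exact hneg
  have hw2 : w - 1 = 1 - α := by rw [hw]; ring
  rw [hw2] at hhead
  have e1 : lam.re / (α - 1) = - (lam.re / (1 - α)) := by rw [← div_neg]; congr 1; ring
  have e2 : lam.re * w ^ N / (1 - α) = lam.re * ((w ^ N - 1) / (1 - α)) + lam.re / (1 - α) := by
    ring
  rw [e2]
  rw [e1] at hfin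
  have : (reCLM (h α)) = (h α).re := rfl
  linarith

/-- `(s - 1) ζ(s)` as an entire function. -/
noncomputable def Zt : ℂ → ℂ := DirichletCharacter.LFunctionTrivChar₁ 1

lemma Zt_diff : Differentiable ℂ Zt := DirichletCharacter.differentiable_LFunctionTrivChar₁ 1

lemma Zt_one : Zt 1 = 1 := by simp [Zt, DirichletCharacter.LFunctionTrivChar₁]

lemma Zt_of_ne {s : ℂ} (hs : s ≠ 1) : Zt s = (s - 1) * riemannZeta s := by
  rw [Zt, DirichletCharacter.LFunctionTrivChar₁, Function.update_of_ne hs,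
    DirichletCharacter.LFunctionTrivChar, DirichletCharacter.LFunction_modOne_eq]

lemma iteratedDeriv_inv_sub_one (m : ℕ) :
    (-1) ^ m * iteratedDeriv m (fun s : ℂ => (s - 1)⁻¹) 2 = (m.factorial : ℂ) := by
  rw [iteratedDeriv_comp_sub_const m (fun s : ℂ => s⁻¹) 1]
  simp only
  rw [iteratedDeriv_eq_iterate]
  have := iter_deriv_inv (𝕜 := ℂ) m (2 - 1)
  rw [show (Inv.inv : ℂ → ℂ) = fun s => s⁻¹ from rfl] at this
  rw [this, ← mul_assoc, ← mul_assoc, ← mul_pow]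
  norm_num

lemma estermann (c1 : ℝ) (hc1 : 0 < c1) (hc1' : c1 ≤ 1) : ∃ c0 > 0, ∃ K > 0,
    ∀ (G : ℂ → ℂ) (B : ℝ), Differentiable ℂ G → 1 ≤ B →
    (∀ s ∈ Metric.closedBall (2 : ℂ) (4 / 3), ‖G s‖ ≤ B) →
    Alt (fun s => riemannZeta s * G s) → c1 ≤ (riemannZeta 2 * G 2).re →
    ∀ α : ℝ, 9 / 10 ≤ α → α < 1 → (riemannZeta α * G α).re ≤ 0 →
    c0 * (1 - α) * B ^ (-(K * (1 - α))) ≤ (G 1).re := by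
  obtain ⟨C', hC'⟩ := (isCompact_closedBall (2 : ℂ) (4 / 3)).exists_bound_of_continuousOn
    Zt_diff.continuous.continuousOn
  set C : ℝ := 3 * (|C'| + 1) with hC
  have hC1 : 1 ≤ C := by have := abs_nonneg C'; linarith
  set K : ℝ := 1 / Real.log (6 / 5) with hK
  have hlog : 0 < Real.log (6 / 5) := Real.log_pos (by norm_num)
  have hK0 : 0 < K := by positivity
  refine ⟨c1 / 2 / (Real.exp 1 * (12 * C / c1) ^ K), by positivity, K, hK0, ?_⟩
  intro G B hG hB hGB hAlt hG2 α h9 h1 hneg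
  set h : ℂ → ℂ := dslope (fun s => Zt s * G s) 1 with hh
  have hFd : Differentiable ℂ (fun s => Zt s * G s) := Zt_diff.mul hG
  have hd : Differentiable ℂ h := by
    rw [← differentiableOn_univ]
    exact (Complex.differentiableOn_dslope Filter.univ_mem).2 hFd.differentiableOn
  have hne : ∀ s : ℂ, s ≠ 1 → h s = riemannZeta s * G s - G 1 * (s - 1)⁻¹ := by
    intro s hs
    have hs' : s - 1 ≠ 0 := sub_ne_zero.2 hs
    rw [hh, dslope_of_ne _ hs, slope_def_field, Zt_of_ne hs, Zt_one]
    field_simp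
  have hmem1 : (1 : ℂ) ∈ Metric.closedBall (2 : ℂ) (4 / 3) := by
    rw [mem_closedBall_iff_norm]; norm_num
  have hM : ∀ s ∈ Metric.sphere (2 : ℂ) (4 / 3), ‖h s‖ ≤ C * B := by
    intro s hs
    have hs3 : 1 / 3 ≤ ‖s - 1‖ := by
      rw [mem_sphere_iff_norm] at hs
      have := norm_sub_norm_le (s - 2) (-1)
      rw [hs, norm_neg, norm_one] at this
      have e : s - 2 - -1 = s - 1 := by ring
      rw [e] at this; linarith
    have hs1 : s ≠ 1 := by
      rintro rfl; norm_num at hs3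
    have hsb := Metric.sphere_subset_closedBall hs
    rw [hh, dslope_of_ne _ hs1, slope_def_field, Zt_one, norm_div, div_le_iff₀ (by linarith)]
    have b1 := hGB s hsb
    have b2 := hGB 1 hmem1
    have b3 := (hC' s hsb).trans (le_abs_self _)
    calc ‖Zt s * G s - 1 * G 1‖ ≤ ‖Zt s‖ * ‖G s‖ + ‖G 1‖ := by
          refine (norm_sub_le _ _).trans ?_; rw [norm_mul, one_mul]
      _ ≤ |C'| * B + B := by gcongr
      _ = C * B * (1 / 3) := by rw [hC]; ring
      _ ≤ C * B * ‖s - 1‖ := by gcongr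
  have h2ne : (2 : ℂ) ≠ 1 := by norm_num
  have hev : h =ᶠ[𝓝 2] fun s => riemannZeta s * G s - G 1 * (s - 1)⁻¹ := by
    filter_upwards [isOpen_ne.mem_nhds h2ne] with s hs using hne s hs
  have hfa : AnalyticAt ℂ (fun s => riemannZeta s * G s) 2 := by
    have : DifferentiableOn ℂ (fun s => riemannZeta s * G s) {s | s ≠ 1} := fun s hs =>
      ((differentiableAt_riemannZeta hs).mul (hG s)).differentiableWithinAt
    exact this.analyticAt (isOpen_ne.mem_nhds h2ne)
  have hga : AnalyticAt ℂ (fun s : ℂ => (s - 1)⁻¹) 2 := by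
    refine AnalyticAt.inv (by fun_prop) (by norm_num)
  set b : ℕ → ℝ := fun m =>
    ((-1) ^ m * iteratedDeriv m (fun s => riemannZeta s * G s) 2).re / m.factorial with hbdef
  have hb : ∀ m, 0 ≤ b m := fun m => div_nonneg (Complex.nonneg_iff.1 (hAlt m)).1 (by positivity)
  have hco : ∀ m : ℕ, (-1) ^ m * iteratedDeriv m h 2 / (m.factorial : ℂ) = b m - G 1 := by
    intro m
    have hfac : (m.factorial : ℂ) ≠ 0 := by exact_mod_cast m.factorial_ne_zero
    rw [hev.iteratedDeriv_eq, iteratedDeriv_fun_sub hfa.contDiffAt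
      (contDiffAt_const.mul hga.contDiffAt), iteratedDeriv_const_mul_field, mul_sub, mul_left_comm,
      iteratedDeriv_inv_sub_one, sub_div, mul_div_cancel_right₀ _ hfac]
    congr 1
    rw [hbdef]
    push_cast
    congr 1
    exact Complex.ext (by simp) (by simpa using (Complex.nonneg_iff.1 (hAlt m)).2.symm)
  have hb0 : c1 ≤ b 0 := by simpa [hbdef] using hG2
  have hα1 : (α : ℂ) ≠ 1 := by exact_mod_cast h1.ne
  have hneg' : (h α + G 1 / (α - 1)).re ≤ 0 := by
    rw [hne _ hα1]
    convert hneg using 2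
    rw [div_eq_mul_inv]; ring
  set A : ℝ := 12 * C * B / c1 with hA
  have hA1 : 1 < A := by
    rw [hA, lt_div_iff₀ hc1]; nlinarith
  have hA0 : 0 < A := by linarith
  have hlogA : 0 < Real.log A := Real.log_pos hA1
  set N : ℕ := ⌈Real.log A * K⌉₊ with hN
  have hNpos : 0 < N := Nat.ceil_pos.2 (by positivity)
  have hmain := estermann_aux h hd (C * B) hM (G 1) b hb c1 hb0 hco α h9 h1 hneg' N hNpos
  have hNA : A ≤ (6 / 5 : ℝ) ^ N := by
    rw [← Real.log_le_log_iff hA0 (by positivity), Real.log_pow]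
    have : Real.log A * K ≤ N := Nat.le_ceil _
    rw [hK, mul_one_div, div_le_iff₀ hlog] at this
    exact this
  have htail : 6 * (C * B) * (5 / 6) ^ N ≤ c1 / 2 := by
    have e : (5 / 6 : ℝ) ^ N = ((6 / 5 : ℝ) ^ N)⁻¹ := by rw [← inv_pow]; norm_num
    rw [e, ← div_eq_mul_inv, div_le_iff₀ (by positivity)]
    have : 6 * (C * B) = c1 / 2 * A := by rw [hA]; field_simp; ring
    rw [this]
    gcongr
  have hw : (2 - α) ^ N ≤ Real.exp 1 * (12 * C / c1) ^ K * B ^ (K * (1 - α)) := by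
    have hb1 : 0 < 1 - α := by linarith
    calc (2 - α) ^ N ≤ (Real.exp (1 - α)) ^ N := by
          have := Real.add_one_le_exp (1 - α)
          exact pow_le_pow_left₀ (by linarith) (by linarith) _
      _ = Real.exp ((1 - α) * N) := by rw [← Real.exp_nat_mul, mul_comm]
      _ ≤ Real.exp (1 + Real.log A * (K * (1 - α))) := by
          refine Real.exp_le_exp.2 ?_
          have : (N : ℝ) < Real.log A * K + 1 := Nat.ceil_lt_add_one (by positivity)
          nlinarith
      _ = Real.exp 1 * A ^ (K * (1 - α)) := by rw [Real.exp_add, Real.rpow_def_of_pos hA0]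
      _ = Real.exp 1 * ((12 * C / c1) ^ (K * (1 - α)) * B ^ (K * (1 - α))) := by
          rw [← Real.mul_rpow (by positivity) (by positivity)]; congr 2; rw [hA]; ring
      _ ≤ Real.exp 1 * ((12 * C / c1) ^ K * B ^ (K * (1 - α))) := by
          have : 1 ≤ 12 * C / c1 := by rw [le_div_iff₀ hc1]; linarith
          gcongr
          nlinarith
      _ = _ := by ring
  have h1α : 0 < 1 - α := by linarith
  have hlam : c1 / 2 * (1 - α) ≤ (G 1).re * (2 - α) ^ N := by
    have : c1 / 2 ≤ (G 1).re * (2 - α) ^ N / (1 - α) := by linarith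
    rwa [le_div_iff₀ h1α] at this
  have hpw : 0 < (2 - α) ^ N := pow_pos (by linarith) _
  have hlampos : 0 ≤ (G 1).re := by
    by_contra hcon
    push Not at hcon
    nlinarith [mul_pos hc1 h1α, mul_neg_of_neg_of_pos hcon hpw]
  have h5 := hlam.trans (mul_le_mul_of_nonneg_left hw hlampos)
  have hBp : 0 < B ^ (K * (1 - α)) := by positivity
  rw [Real.rpow_neg (by linarith), ← div_eq_mul_inv, div_le_iff₀ hBp, div_mul_eq_mul_div,
    div_le_iff₀ (by positivity)]
  linarith


lemma alt_of_logDeriv (f D : ℂ → ℂ) (hf : AnalyticAt ℂ f 2) (hD : AnalyticAt ℂ D 2)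
    (hfD : deriv f =ᶠ[𝓝 2] fun s => -(f s * D s)) (h0 : 0 ≤ f 2) (hDalt : Alt D) : Alt f := by
  intro m
  induction m using Nat.strong_induction_on with
  | _ m ih =>
    cases m with
    | zero => simpa using h0
    | succ m =>
      rw [iteratedDeriv_succ', hfD.iteratedDeriv_eq, iteratedDeriv_fun_neg,
        iteratedDeriv_fun_mul hf.contDiffAt hD.contDiffAt, pow_succ, mul_neg_one, neg_mul_neg,
        Finset.mul_sum]
      refine Finset.sum_nonneg fun i hi => ?_
      have hi' : i ≤ m := Nat.lt_succ_iff.1 (Finset.mem_range.1 hi)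
      have h1 := ih i (by omega)
      have h2 := hDalt (m - i)
      have e : (-1 : ℂ) ^ m = (-1) ^ i * (-1) ^ (m - i) := by
        rw [← pow_add]; congr 1; omega
      have h3 : (0 : ℂ) ≤ (m.choose i : ℂ) := by exact_mod_cast Nat.zero_le _
      have := mul_nonneg h3 (mul_nonneg h1 h2)
      rw [e]
      convert this using 1
      ring

/-- The negative logarithmic derivative of f is the L-series of `a` on `re s > 1`. -/
def HasLD (f : ℂ → ℂ) (a : ℕ → ℂ) : Prop :=
  ∀ s : ℂ, 1 < s.re → LSeriesSummable a s ∧ HasDerivAt f (-(f s * LSeries a s)) s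

lemma HasLD.mul {f g : ℂ → ℂ} {a b : ℕ → ℂ} (hf : HasLD f a) (hg : HasLD g b) :
    HasLD (fun s => f s * g s) (a + b) := by
  intro s hs
  refine ⟨(hf s hs).1.add (hg s hs).1, ?_⟩
  have e : -(f s * g s * LSeries (a + b) s) =
      -(f s * LSeries a s) * g s + f s * -(g s * LSeries b s) := by
    rw [LSeries_add (hf s hs).1 (hg s hs).1]
    ring
  rw [e]
  exact (hf s hs).2.mul (hg s hs).2

lemma HasLD.alt {f : ℂ → ℂ} {a : ℕ → ℂ} (hf : HasLD f a) (ha : 0 ≤ a) (h2 : 0 ≤ f 2) : Alt f := by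
  have hmem : {s : ℂ | 1 < s.re} ∈ 𝓝 (2 : ℂ) :=
    (isOpen_lt continuous_const continuous_re).mem_nhds (by simp)
  have habs : LSeries.abscissaOfAbsConv a < ((2 : ℝ) : EReal) := by
    have := (hf (3 / 2 : ℝ) (by simp; norm_num)).1.abscissaOfAbsConv_le
    refine this.trans_lt ?_
    rw [ofReal_re]
    exact_mod_cast (by norm_num : (3 / 2 : ℝ) < 2)
  refine alt_of_logDeriv f (LSeries a) ?_ ?_ ?_ h2 ?_
  · have : DifferentiableOn ℂ f {s : ℂ | 1 < s.re} := fun s hs =>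
      (hf s hs).2.differentiableAt.differentiableWithinAt
    exact this.analyticAt hmem
  · exact LSeries_analyticOnNhd a 2 (by simpa using! habs)
  · filter_upwards [hmem] with s hs using (hf s hs).2.deriv
  · intro m
    simpa using LSeries.iteratedDeriv_alternating ha habs m

/-- coefficients of the negative logarithmic derivative of `L(s + δ, χ)`. -/
noncomputable def ldCoeff {N : ℕ} (χ : DirichletCharacter ℂ N) (δ : ℝ) (n : ℕ) : ℂ :=
  χ n * (ArithmeticFunction.vonMangoldt n : ℂ) * ((n : ℝ) ^ (-δ) : ℝ)

lemma term_ldCoeff {N : ℕ} (χ : DirichletCharacter ℂ N) (δ : ℝ) (s : ℂ) :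
    LSeries.term (ldCoeff χ δ) s =
      LSeries.term ((fun n : ℕ => χ n) * fun n : ℕ => (ArithmeticFunction.vonMangoldt n : ℂ))
        (s + δ) := by
  funext n
  rcases eq_or_ne n 0 with rfl | hn
  · simp
  · have hn' : (n : ℂ) ≠ 0 := by exact_mod_cast hn
    rw [LSeries.term_of_ne_zero hn, LSeries.term_of_ne_zero hn, ldCoeff, Pi.mul_apply,
      cpow_add _ _ hn', ofReal_cpow (by positivity)]
    push_cast
    rw [cpow_neg]
    field_simp

lemma hasLD_LFunction {N : ℕ} [NeZero N] (χ : DirichletCharacter ℂ N) {δ : ℝ} (hδ : 0 ≤ δ) :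
    HasLD (fun s => DirichletCharacter.LFunction χ (s + δ)) (ldCoeff χ δ) := by
  intro s hs
  have hs' : 1 < (s + δ).re := by simp; linarith
  have hsum := DirichletCharacter.LSeriesSummable_twist_vonMangoldt χ hs'
  refine ⟨?_, ?_⟩
  · rw [LSeriesSummable, term_ldCoeff]; exact hsum
  · have e : LSeries (ldCoeff χ δ) s = -deriv (DirichletCharacter.LFunction χ) (s + δ) /
        DirichletCharacter.LFunction χ (s + δ) := by
      rw [LSeries, term_ldCoeff, DirichletCharacter.deriv_LFunction_eq_deriv_LSeries χ hs',
        DirichletCharacter.LFunction_eq_LSeries χ hs']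
      exact DirichletCharacter.LSeries_twist_vonMangoldt_eq χ hs'
    have hne1 : s + δ ≠ 1 := by
      intro h; rw [h] at hs'; simp at hs'
    have hne : DirichletCharacter.LFunction χ (s + δ) ≠ 0 :=
      DirichletCharacter.LFunction_ne_zero_of_one_le_re χ (Or.inr hne1) hs'.le
    rw [e, mul_div_cancel₀ _ hne, neg_neg]
    have := (DirichletCharacter.differentiableAt_LFunction χ _ (Or.inl hne1)).hasDerivAt
    exact this.comp_add_const s δ

lemma hasLD_zeta : HasLD riemannZeta (fun n => (ArithmeticFunction.vonMangoldt n : ℂ)) := by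
  have h := hasLD_LFunction (1 : DirichletCharacter ℂ 1) (le_refl (0 : ℝ))
  have e : ldCoeff (1 : DirichletCharacter ℂ 1) 0 =
      fun n => (ArithmeticFunction.vonMangoldt n : ℂ) := by
    funext n
    simp [ldCoeff, Subsingleton.elim (n : ZMod 1) 1]
  rw [e] at h
  simpa using h

lemma LFunction_sub_one {N : ℕ} [NeZero N] (χ : DirichletCharacter ℂ N) {x : ℝ} (hx : 2 ≤ x) :
    ‖DirichletCharacter.LFunction χ x - 1‖ ≤ 2 / 3 := by
  have hs : 1 < (x : ℂ).re := by simp; linarith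
  rw [DirichletCharacter.LFunction_eq_LSeries χ hs]
  have h1 : HasSum (fun n : ℕ => if n = 1 then (1 : ℂ) else 0) 1 := hasSum_ite_eq 1 1
  have h1' : HasSum (fun n : ℕ => if n = 1 then (1 : ℝ) else 0) 1 := hasSum_ite_eq 1 1
  have h2 := (DirichletCharacter.LSeriesSummable_of_one_lt_re χ hs).hasSum.sub h1
  have h3 := hasSum_zeta_two.sub h1'
  have : ‖LSeries (fun n => χ n) x - 1‖ ≤ Real.pi ^ 2 / 6 - 1 := by
    rw [LSeries, ← h2.tsum_eq]
    refine tsum_of_norm_bounded h3 fun n => ?_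
    rcases Nat.lt_or_ge n 2 with hn | hn
    · interval_cases n <;> simp
    · have hn1 : n ≠ 1 := by omega
      have hn0 : n ≠ 0 := by omega
      simp only [hn1, if_false, sub_zero]
      rw [LSeries.norm_term_eq, if_neg hn0, ofReal_re]
      have hn2 : (1 : ℝ) ≤ n := by exact_mod_cast (by omega : 1 ≤ n)
      have hp : (n : ℝ) ^ 2 ≤ (n : ℝ) ^ x := by
        rw [← Real.rpow_two]; exact Real.rpow_le_rpow_of_exponent_le hn2 hx
      have := χ.norm_le_one (n : ZMod N)
      gcongr
  refine this.trans ?_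
  have := Real.pi_lt_d2
  have := Real.pi_pos
  nlinarith

lemma LFunction_re_ge {N : ℕ} [NeZero N] (χ : DirichletCharacter ℂ N) {x : ℝ} (hx : 2 ≤ x) :
    1 / 3 ≤ (DirichletCharacter.LFunction χ x).re := by
  have := (abs_re_le_norm _).trans (LFunction_sub_one χ hx)
  have := (abs_le.1 this).1
  simp at this
  linarith

lemma LFunction_pos_of_no_zero {N : ℕ} [NeZero N] (χ : DirichletCharacter ℂ N) (hχ : χ ≠ 1)
    (hq : χ ^ 2 = 1) {a : ℝ} (ha : 0 < a)
    (hz : ∀ x : ℝ, a ≤ x → x ≤ 2 → DirichletCharacter.LFunction χ x ≠ 0) :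
    0 < (DirichletCharacter.LFunction χ a).re := by
  rcases le_or_gt 2 a with h2 | h2
  · have := LFunction_re_ge χ h2; linarith
  by_contra hcon
  push Not at hcon
  have hc : ContinuousOn (fun x : ℝ => (DirichletCharacter.LFunction χ x).re) (Set.Icc a 2) := by
    have := (DirichletCharacter.differentiable_LFunction hχ).continuous
    exact (continuous_re.comp (this.comp continuous_ofReal)).continuousOn
  have h3 := LFunction_re_ge χ (le_refl 2)
  obtain ⟨x, hx, hx0⟩ := intermediate_value_Icc h2.le hc (show (0 : ℝ) ∈ _ from ⟨hcon, by linarith⟩)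
  refine hz x hx.1 hx.2 (Complex.ext hx0 ?_)
  exact LFunction_im χ hχ hq (ha.trans_le hx.1)

lemma LFunction_pos {N : ℕ} [NeZero N] (χ : DirichletCharacter ℂ N) (hχ : χ ≠ 1)
    (hq : χ ^ 2 = 1) {x : ℝ} (hx : 1 ≤ x) : 0 < (DirichletCharacter.LFunction χ x).re := by
  refine LFunction_pos_of_no_zero χ hχ hq (by linarith) fun y hy _ => ?_
  exact DirichletCharacter.LFunction_ne_zero_of_one_le_re χ (Or.inl hχ) (by simp; linarith)

lemma LFunction_eq_re {N : ℕ} [NeZero N] (χ : DirichletCharacter ℂ N) (hχ : χ ≠ 1)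
    (hq : χ ^ 2 = 1) {x : ℝ} (hx : 0 < x) :
    DirichletCharacter.LFunction χ x = ((DirichletCharacter.LFunction χ x).re : ℂ) :=
  Complex.ext (by simp) (by simpa using LFunction_im χ hχ hq hx)

lemma zeta_two_re : riemannZeta 2 = ((Real.pi ^ 2 / 6 : ℝ) : ℂ) := by
  rw [riemannZeta_two]; push_cast; ring

lemma zeta_two_ge : 1 ≤ Real.pi ^ 2 / 6 := by
  have := Real.pi_gt_three
  nlinarith

lemma vM_pow_bounds (n : ℕ) {δ : ℝ} (hδ : 0 ≤ δ) :
    ArithmeticFunction.vonMangoldt n = 0 ∨ ((n : ℝ) ^ (-δ) ≤ 1 ∧ 0 ≤ (n : ℝ) ^ (-δ)) := by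
  rcases Nat.eq_zero_or_pos n with rfl | hn
  · left; simp
  · right
    have : (1 : ℝ) ≤ n := by exact_mod_cast hn
    exact ⟨Real.rpow_le_one_of_one_le_of_nonpos this (by linarith), by positivity⟩

lemma zero_le_of_eq_ofReal {z : ℂ} {x : ℝ} (h : z = x) (hx : 0 ≤ x) : 0 ≤ z := by
  rw [h]; exact_mod_cast hx

lemma altA {N : ℕ} [NeZero N] (χ : DirichletCharacter ℂ N) (hχ : χ ≠ 1) (hq : χ ^ 2 = 1)
    {δ : ℝ} (hδ : 0 ≤ δ) :
    Alt (fun s => riemannZeta s * DirichletCharacter.LFunction χ (s + δ)) := by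
  refine HasLD.alt (hasLD_zeta.mul (hasLD_LFunction χ hδ)) ?_ ?_
  · intro n
    simp only [Pi.zero_apply, Pi.add_apply, ldCoeff]
    set y : ℝ := (n : ℝ) ^ (-δ) with hy
    have hL : 0 ≤ ArithmeticFunction.vonMangoldt n := ArithmeticFunction.vonMangoldt_nonneg
    rcases vM_pow_bounds n hδ with h0 | ⟨h1, h2⟩
    · rw [h0]; simp
    · rw [← hy] at h1 h2
      rcases real_char χ hq n with h | h | h
      · refine zero_le_of_eq_ofReal (x := ArithmeticFunction.vonMangoldt n) ?_ hL
        rw [h]; simp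
      · refine zero_le_of_eq_ofReal (x := ArithmeticFunction.vonMangoldt n * (1 + y)) ?_
          (mul_nonneg hL (by linarith))
        rw [h]; push_cast; ring
      · refine zero_le_of_eq_ofReal (x := ArithmeticFunction.vonMangoldt n * (1 - y)) ?_
          (mul_nonneg hL (by linarith))
        rw [h]; push_cast; ring
  · have e : (2 : ℂ) + δ = ((2 + δ : ℝ) : ℂ) := by push_cast; ring
    simp only [e]
    rw [LFunction_eq_re χ hχ hq (x := 2 + δ) (by linarith), zeta_two_re]
    have := LFunction_re_ge χ (x := 2 + δ) (by linarith)
    rw [← ofReal_mul]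
    refine zero_le_of_eq_ofReal rfl ?_
    have := zeta_two_ge
    positivity

lemma two_ge_A {N : ℕ} [NeZero N] (χ : DirichletCharacter ℂ N)
    {δ : ℝ} (hδ : 0 ≤ δ) :
    1 / 27 ≤ (riemannZeta 2 * DirichletCharacter.LFunction χ (2 + δ)).re := by
  have e : (2 : ℂ) + δ = ((2 + δ : ℝ) : ℂ) := by push_cast; ring
  rw [e, zeta_two_re, re_ofReal_mul]
  have := LFunction_re_ge χ (x := 2 + δ) (by linarith)
  have := zeta_two_ge
  nlinarith

lemma valB {N N1 M : ℕ} [NeZero N] [NeZero N1] [NeZero M] (χ : DirichletCharacter ℂ N)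
    (hχ : χ ≠ 1) (hq : χ ^ 2 = 1) (χ1 : DirichletCharacter ℂ N1) (hχ1 : χ1 ≠ 1) (hq1 : χ1 ^ 2 = 1)
    (ψ : DirichletCharacter ℂ M) (hψ : ψ ≠ 1) (hqψ : ψ ^ 2 = 1) {δ : ℝ} (hδ : 0 ≤ δ) :
    ∃ x : ℝ, 1 / 27 ≤ x ∧ riemannZeta 2 * (DirichletCharacter.LFunction χ1 2 *
      (DirichletCharacter.LFunction χ (2 + δ) * DirichletCharacter.LFunction ψ (2 + δ))) = x := by
  have e : (2 : ℂ) + δ = ((2 + δ : ℝ) : ℂ) := by push_cast; ring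
  have e2 : (2 : ℂ) = ((2 : ℝ) : ℂ) := by push_cast; ring
  have h1 := LFunction_re_ge χ (x := 2 + δ) (by linarith)
  have h2 := LFunction_re_ge ψ (x := 2 + δ) (by linarith)
  have h3 := LFunction_re_ge χ1 (x := 2) (by linarith)
  have h4 := zeta_two_ge
  refine ⟨Real.pi ^ 2 / 6 * ((DirichletCharacter.LFunction χ1 (2 : ℝ)).re *
    ((DirichletCharacter.LFunction χ (2 + δ : ℝ)).re *
      (DirichletCharacter.LFunction ψ (2 + δ : ℝ)).re)), ?_, ?_⟩
  · calc (1 / 27 : ℝ) = 1 * (1 / 3 * (1 / 3 * (1 / 3))) := by norm_num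
      _ ≤ _ := by gcongr
  · rw [e, zeta_two_re, LFunction_eq_re χ hχ hq (x := 2 + δ) (by linarith),
      LFunction_eq_re ψ hψ hqψ (x := 2 + δ) (by linarith), e2,
      LFunction_eq_re χ1 hχ1 hq1 (x := 2) (by linarith)]
    simp only [ofReal_mul, ofReal_re]

lemma altB {N N1 M : ℕ} [NeZero N] [NeZero N1] [NeZero M] (χ : DirichletCharacter ℂ N)
    (hχ : χ ≠ 1) (hq : χ ^ 2 = 1) (χ1 : DirichletCharacter ℂ N1) (hχ1 : χ1 ≠ 1) (hq1 : χ1 ^ 2 = 1)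
    (ψ : DirichletCharacter ℂ M) (hψ : ψ ≠ 1) (hqψ : ψ ^ 2 = 1)
    (hmul : ∀ n : ℕ, ψ n = χ1 n * χ n) {δ : ℝ} (hδ : 0 ≤ δ) :
    Alt (fun s => riemannZeta s * (DirichletCharacter.LFunction χ1 s *
      (DirichletCharacter.LFunction χ (s + δ) * DirichletCharacter.LFunction ψ (s + δ)))) := by
  have hL1 : HasLD (DirichletCharacter.LFunction χ1) (ldCoeff χ1 0) := by
    simpa using hasLD_LFunction χ1 (le_refl (0 : ℝ))
  refine HasLD.alt (hasLD_zeta.mul (hL1.mul ((hasLD_LFunction χ hδ).mul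
    (hasLD_LFunction ψ hδ)))) ?_ ?_
  · intro n
    simp only [Pi.zero_apply, Pi.add_apply, ldCoeff, hmul]
    set y : ℝ := (n : ℝ) ^ (-δ) with hy
    have hL : 0 ≤ ArithmeticFunction.vonMangoldt n := ArithmeticFunction.vonMangoldt_nonneg
    rcases vM_pow_bounds n hδ with h0 | ⟨h1, h2⟩
    · rw [h0]; simp
    · rw [← hy] at h1 h2
      obtain ⟨a, ha, ha0⟩ : ∃ a : ℝ, χ1 n = a ∧ 0 ≤ 1 + a := by
        rcases real_char χ1 hq1 n with h | h | h
        · exact ⟨0, by simp [h], by norm_num⟩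
        · exact ⟨1, by simp [h], by norm_num⟩
        · exact ⟨-1, by simp [h], by norm_num⟩
      obtain ⟨b, hb, hb0⟩ : ∃ b : ℝ, χ n = b ∧ 0 ≤ 1 + b * y := by
        rcases real_char χ hq n with h | h | h
        · exact ⟨0, by simp [h], by norm_num⟩
        · exact ⟨1, by simp [h], by linarith⟩
        · exact ⟨-1, by simp [h], by linarith⟩
      refine zero_le_of_eq_ofReal
        (x := ArithmeticFunction.vonMangoldt n * ((1 + a) * (1 + b * y))) ?_
        (mul_nonneg hL (mul_nonneg ha0 hb0))
      rw [ha, hb, neg_zero, Real.rpow_zero]; push_cast; ring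
  · obtain ⟨x, hx, hx'⟩ := valB χ hχ hq χ1 hχ1 hq1 ψ hψ hqψ hδ
    exact zero_le_of_eq_ofReal hx' (by linarith)

lemma LFunction_ball_bound {N : ℕ} [NeZero N] (χ : DirichletCharacter ℂ N) (hχ : χ ≠ 1)
    {δ : ℝ} (hδ : 0 ≤ δ) (hδ1 : δ ≤ 1) {s : ℂ} (hs : s ∈ Metric.closedBall (2 : ℂ) (4 / 3)) :
    ‖DirichletCharacter.LFunction χ (s + δ)‖ ≤ 8 * N := by
  rw [mem_closedBall_iff_norm] at hs
  have hre : 2 / 3 ≤ s.re := by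
    have := (abs_le.1 ((abs_re_le_norm _).trans hs)).1
    simp at this; linarith
  have hn : ‖s + δ‖ ≤ 13 / 3 := by
    have e : s + δ = (s - 2) + ((2 + δ : ℝ) : ℂ) := by push_cast; ring
    rw [e]
    refine (norm_add_le _ _).trans ?_
    rw [norm_real, Real.norm_of_nonneg (by linarith)]
    linarith
  have hre' : 2 / 3 ≤ (s + δ).re := by simp; linarith
  have h := norm_LFunction_le χ hχ (η := 1) (by norm_num) le_rfl (s := s + δ) (by linarith)
    (by linarith)
  refine h.trans ?_
  rw [Real.rpow_one]
  have hden : 2 / 3 ≤ (s + δ).re - 1 + 1 := by linarith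
  calc ‖s + δ‖ * ((N : ℝ) / ((s + δ).re - 1 + 1)) ≤ 13 / 3 * (N / (2 / 3)) := by gcongr
    _ = 13 / 2 * N := by ring
    _ ≤ 8 * N := by gcongr; norm_num

lemma zeta_neg_near_one : ∃ e0 > 0, e0 ≤ (1 / 10 : ℝ) ∧
    ∀ α : ℝ, 1 - e0 < α → α < 1 → (riemannZeta α).re < 0 := by
  have hc : ContinuousAt (fun x : ℝ => (Zt x).re) 1 :=
    (continuous_re.comp (Zt_diff.continuous.comp continuous_ofReal)).continuousAt
  have h1 : (0 : ℝ) < (Zt ((1 : ℝ) : ℂ)).re := by rw [ofReal_one, Zt_one]; simp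
  obtain ⟨e, he, h⟩ := Metric.eventually_nhds_iff.1 (hc.eventually (lt_mem_nhds h1))
  refine ⟨min e (1 / 10), by positivity, min_le_right _ _, fun α h2 h3 => ?_⟩
  have h4 : (0 : ℝ) < (Zt α).re := by
    refine h ?_
    rw [Real.dist_eq, abs_lt]
    have := min_le_left e (1 / 10)
    constructor <;> linarith
  have hne : (α : ℂ) ≠ 1 := by exact_mod_cast h3.ne
  rw [Zt_of_ne hne, show (α : ℂ) - 1 = ((α - 1 : ℝ) : ℂ) by push_cast; ring, re_ofReal_mul] at h4
  by_contra hcon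
  push Not at hcon
  nlinarith

lemma prodChar_apply {N N1 : ℕ} [NeZero N] [NeZero N1] (χ : DirichletCharacter ℂ N)
    (χ1 : DirichletCharacter ℂ N1) (n : ℕ) :
    (DirichletCharacter.changeLevel (Nat.dvd_mul_right N1 N) χ1 *
      DirichletCharacter.changeLevel (Nat.dvd_mul_left N N1) χ) (n : ZMod (N1 * N)) =
      χ1 n * χ n := by
  rw [MulChar.mul_apply]
  by_cases hco : IsCoprime (n : ℤ) ((N1 * N : ℕ) : ℤ)
  · have h1 := DirichletCharacter.changeLevel_eq_cast_of_dvd' χ1 (Nat.dvd_mul_right N1 N) hco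
    have h2 := DirichletCharacter.changeLevel_eq_cast_of_dvd' χ (Nat.dvd_mul_left N N1) hco
    simp only [Int.cast_natCast] at h1 h2
    rw [h1, h2]
  · have h1 := (DirichletCharacter.apply_eq_zero_iff
      (DirichletCharacter.changeLevel (Nat.dvd_mul_right N1 N) χ1) (n : ℤ)).2 hco
    rw [Int.cast_natCast] at h1
    rw [h1, zero_mul]
    symm
    rw [Nat.cast_mul, IsCoprime.mul_right_iff, not_and_or] at hco
    rcases hco with h | h
    · have := (DirichletCharacter.apply_eq_zero_iff χ1 (n : ℤ)).2 h
      rw [Int.cast_natCast] at this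
      rw [this, zero_mul]
    · have := (DirichletCharacter.apply_eq_zero_iff χ (n : ℤ)).2 h
      rw [Int.cast_natCast] at this
      rw [this, mul_zero]

lemma single_char {N : ℕ} [NeZero N] (χ : DirichletCharacter ℂ N) (hχ : χ ≠ 1)
    (hq : χ ^ 2 = 1) : ∃ c > 0, ∀ δ : ℝ, 0 ≤ δ → δ ≤ 1 →
      c ≤ (DirichletCharacter.LFunction χ (1 + δ)).re := by
  have hc : ContinuousOn (fun x : ℝ => (DirichletCharacter.LFunction χ (1 + x)).re)
      (Set.Icc 0 1) := by
    have := (DirichletCharacter.differentiable_LFunction hχ).continuous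
    refine Continuous.continuousOn ?_
    exact continuous_re.comp (this.comp (continuous_const.add continuous_ofReal))
  obtain ⟨x, hx, hmin⟩ := isCompact_Icc.exists_isMinOn (Set.nonempty_Icc.2 zero_le_one) hc
  refine ⟨_, ?_, fun δ h0 h1 => hmin ⟨h0, h1⟩⟩
  have := LFunction_pos χ hχ hq (x := 1 + x) (by linarith [hx.1])
  push_cast at this
  exact this

/-- The pair estimate. -/
lemma caseB_ineq {c0 K : ℝ} (hK : 0 < K) (hc0 : 0 < c0)
    (hest : ∀ (G : ℂ → ℂ) (B : ℝ), Differentiable ℂ G → 1 ≤ B →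
      (∀ s ∈ Metric.closedBall (2 : ℂ) (4 / 3), ‖G s‖ ≤ B) →
      Alt (fun s => riemannZeta s * G s) → 1 / 27 ≤ (riemannZeta 2 * G 2).re →
      ∀ α : ℝ, 9 / 10 ≤ α → α < 1 → (riemannZeta α * G α).re ≤ 0 →
      c0 * (1 - α) * B ^ (-(K * (1 - α))) ≤ (G 1).re)
    {N N1 : ℕ} [NeZero N] [NeZero N1] (χ : DirichletCharacter ℂ N)
    (hχ : χ ≠ 1) (hq : χ ^ 2 = 1) (χ1 : DirichletCharacter ℂ N1) (hχ1 : χ1 ≠ 1) (hq1 : χ1 ^ 2 = 1)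
    (hψ : DirichletCharacter.changeLevel (Nat.dvd_mul_right N1 N) χ1 *
      DirichletCharacter.changeLevel (Nat.dvd_mul_left N N1) χ ≠ 1)
    {β : ℝ} (hβ : 9 / 10 ≤ β) (hβ1 : β < 1) (hz : DirichletCharacter.LFunction χ1 β = 0)
    {δ : ℝ} (hδ : 0 ≤ δ) (hδ1 : δ ≤ 1) {η : ℝ} (hη : 0 < η) (hη1 : η ≤ 1) :
    c0 * (1 - β) * (512 * (N1 : ℝ) ^ 2 * (N : ℝ) ^ 2) ^ (-(K * (1 - β))) ≤
      ‖DirichletCharacter.LFunction χ1 1‖ * ((DirichletCharacter.LFunction χ (1 + δ)).re *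
        (2 * (((N1 : ℝ) * N) ^ η / η))) := by
  set ψ := DirichletCharacter.changeLevel (Nat.dvd_mul_right N1 N) χ1 *
      DirichletCharacter.changeLevel (Nat.dvd_mul_left N N1) χ with hψdef
  have hqψ : ψ ^ 2 = 1 := by
    rw [hψdef, mul_pow, ← map_pow, ← map_pow, hq, hq1, map_one, map_one, one_mul]
  have hN : (1 : ℝ) ≤ N := by exact_mod_cast NeZero.pos N
  have hN1 : (1 : ℝ) ≤ N1 := by exact_mod_cast NeZero.pos N1
  have dχ := DirichletCharacter.differentiable_LFunction hχ
  have dχ1 := DirichletCharacter.differentiable_LFunction hχ1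
  have dψ := DirichletCharacter.differentiable_LFunction hψ
  have h := hest (fun s => DirichletCharacter.LFunction χ1 s *
      (DirichletCharacter.LFunction χ (s + δ) * DirichletCharacter.LFunction ψ (s + δ)))
    (512 * (N1 : ℝ) ^ 2 * (N : ℝ) ^ 2) (by fun_prop) ?_ ?_
    (altB χ hχ hq χ1 hχ1 hq1 ψ hψ hqψ (prodChar_apply χ χ1) hδ) ?_ β hβ hβ1 ?_
  · refine h.trans ((re_le_norm _).trans ?_)
    rw [norm_mul, norm_mul]
    have e : (1 : ℂ) + δ = ((1 + δ : ℝ) : ℂ) := by push_cast; ring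
    have h1 : ‖DirichletCharacter.LFunction χ (1 + δ)‖ =
        (DirichletCharacter.LFunction χ (1 + δ)).re := by
      rw [e]
      have := LFunction_pos χ hχ hq (x := 1 + δ) (by linarith)
      rw [LFunction_eq_re χ hχ hq (x := 1 + δ) (by linarith), norm_real,
        Real.norm_of_nonneg (by simpa using this.le), ofReal_re]
    have h2 : ‖DirichletCharacter.LFunction ψ (1 + δ)‖ ≤ 2 * (((N1 : ℝ) * N) ^ η / η) := by
      have := norm_LFunction_le ψ hψ hη.le hη1 (s := 1 + δ) (by simp; linarith)
        (by simp; linarith)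
      refine this.trans ?_
      push_cast
      have hn : ‖(1 : ℂ) + δ‖ ≤ 2 := by
        rw [e, norm_real, Real.norm_of_nonneg (by linarith)]; linarith
      have hd : η ≤ ((1 : ℂ) + δ).re - 1 + η := by simp; linarith
      have hd0 : 0 ≤ ((N1 : ℝ) * N) ^ η / (((1 : ℂ) + δ).re - 1 + η) :=
        div_nonneg (by positivity) (by linarith)
      gcongr
    rw [h1]
    have : 0 ≤ (DirichletCharacter.LFunction χ (1 + δ)).re := by rw [← h1]; exact norm_nonneg _
    gcongr
  · have : (1 : ℝ) ≤ (N1 : ℝ) ^ 2 := one_le_pow₀ hN1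
    have : (1 : ℝ) ≤ (N : ℝ) ^ 2 := one_le_pow₀ hN
    nlinarith
  · intro s hs
    rw [norm_mul, norm_mul]
    have b1 := LFunction_ball_bound χ1 hχ1 (le_refl 0) zero_le_one hs
    rw [ofReal_zero, add_zero] at b1
    have b2 := LFunction_ball_bound χ hχ hδ hδ1 hs
    have b3 := LFunction_ball_bound ψ hψ hδ hδ1 hs
    push_cast at b3
    calc _ ≤ (8 * (N1 : ℝ)) * ((8 * N) * (8 * (N1 * N))) := by gcongr
      _ = _ := by ring
  · obtain ⟨x, hx, hx'⟩ := valB χ hχ hq χ1 hχ1 hq1 ψ hψ hqψ hδ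
    rw [hx', ofReal_re]; exact hx
  · rw [hz]; simp

lemma siegel_nontriv (ε : ℝ) (hε : 0 < ε) : ∃ c > 0, ∀ (N : ℕ) [NeZero N]
    (χ : DirichletCharacter ℂ N), χ.IsPrimitive → χ ^ 2 = 1 → χ ≠ 1 → ∀ δ : ℝ, 0 ≤ δ → δ ≤ 1 →
      c * (N : ℝ) ^ (-ε) ≤ (DirichletCharacter.LFunction χ (1 + δ)).re := by
  obtain ⟨c0, hc0, K, hK, hest⟩ := estermann (1 / 27) (by norm_num) (by norm_num)
  obtain ⟨e0, he0, he1, hzeta⟩ := zeta_neg_near_one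
  set τ : ℝ := min (e0 / 2) (ε / (4 * K)) with hτ
  have hτ0 : 0 < τ := by positivity
  have hτ1 : τ < e0 := (min_le_left _ _).trans_lt (by linarith)
  have hτ2 : K * τ ≤ ε / 4 := by
    have : τ ≤ ε / (4 * K) := min_le_right _ _
    calc K * τ ≤ K * (ε / (4 * K)) := by gcongr
      _ = ε / 4 := by field_simp
  by_cases hex : ∃ (N1 : ℕ) (_ : NeZero N1) (χ1 : DirichletCharacter ℂ N1), χ1.IsPrimitive ∧
      χ1 ^ 2 = 1 ∧ χ1 ≠ 1 ∧ ∃ β : ℝ, 1 - τ ≤ β ∧ β < 1 ∧ DirichletCharacter.LFunction χ1 β = 0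
  · obtain ⟨N1, _, χ1, hp1, hq1, hχ1, β, hβ, hβ1, hz⟩ := hex
    obtain ⟨c2, hc2, hsingle⟩ := single_char χ1 hχ1 hq1
    have hN1 : (1 : ℝ) ≤ N1 := by exact_mod_cast NeZero.pos N1
    set η : ℝ := min (ε / 2) 1 with hηdef
    have hη : 0 < η := by positivity
    have hη1 : η ≤ 1 := min_le_right _ _
    have hη2 : η ≤ ε / 2 := min_le_left _ _
    have h1β : 0 < 1 - β := by linarith
    have hL1 : 0 < ‖DirichletCharacter.LFunction χ1 1‖ := by
      rw [norm_pos_iff]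
      exact DirichletCharacter.LFunction_ne_zero_of_one_le_re χ1 (Or.inl hχ1) (by simp)
    set c3 : ℝ := c0 * (1 - β) * (512 * (N1 : ℝ) ^ 2) ^ (-(K * (1 - β))) /
      (‖DirichletCharacter.LFunction χ1 1‖ * (2 * ((N1 : ℝ) ^ η / η))) with hc3
    have hc3p : 0 < c3 := by positivity
    refine ⟨min c2 c3, by positivity, ?_⟩
    intro N _ χ hp hq hχ δ hδ hδ1
    have hN : (1 : ℝ) ≤ N := by exact_mod_cast NeZero.pos N
    by_cases hψ : DirichletCharacter.changeLevel (Nat.dvd_mul_right N1 N) χ1 *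
      DirichletCharacter.changeLevel (Nat.dvd_mul_left N N1) χ = 1
    · have heq : DirichletCharacter.changeLevel (Nat.dvd_mul_right N1 N) χ1 =
          DirichletCharacter.changeLevel (Nat.dvd_mul_left N N1) χ := by
        have h2 : DirichletCharacter.changeLevel (Nat.dvd_mul_left N N1) χ *
            DirichletCharacter.changeLevel (Nat.dvd_mul_left N N1) χ = 1 := by
          rw [← map_mul, ← sq, hq, map_one]
        exact mul_right_cancel (hψ.trans h2.symm)
      have hcond := congrArg DirichletCharacter.conductor heq
      rw [DirichletCharacter.conductor_changeLevel, DirichletCharacter.conductor_changeLevel,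
        hp, hp1] at hcond
      subst hcond
      have : χ1 = χ := DirichletCharacter.changeLevel_injective (Nat.dvd_mul_right N1 N1) heq
      subst this
      refine le_trans ?_ (hsingle δ hδ hδ1)
      have h3 : (N1 : ℝ) ^ (-ε) ≤ 1 := Real.rpow_le_one_of_one_le_of_nonpos hN (by linarith)
      calc min c2 c3 * (N1 : ℝ) ^ (-ε) ≤ c2 * 1 := by
            gcongr; exact min_le_left _ _
        _ = c2 := mul_one _
    · have h := caseB_ineq hK hc0 hest χ hχ hq χ1 hχ1 hq1 hψ (by linarith) hβ1 hz hδ hδ1 hη hη1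
      set Lr := (DirichletCharacter.LFunction χ (1 + δ)).re with hLr
      rw [Real.mul_rpow (by positivity) (by positivity),
        Real.mul_rpow (x := (N1 : ℝ)) (by positivity) (by positivity)] at h
      have hNp : 0 < (N : ℝ) ^ η := by positivity
      have key : c3 * ((N : ℝ) ^ 2) ^ (-(K * (1 - β))) ≤ Lr * (N : ℝ) ^ η := by
        rw [hc3, div_mul_eq_mul_div, div_le_iff₀ (by positivity)]
        calc _ = c0 * (1 - β) * ((512 * (N1 : ℝ) ^ 2) ^ (-(K * (1 - β))) *
              ((N : ℝ) ^ 2) ^ (-(K * (1 - β)))) := by ring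
          _ ≤ _ := h
          _ = _ := by ring
      have hexp : (N : ℝ) ^ (-ε) * (N : ℝ) ^ η ≤ ((N : ℝ) ^ 2) ^ (-(K * (1 - β))) := by
        rw [← Real.rpow_two, ← Real.rpow_mul (by linarith), ← Real.rpow_add (by linarith)]
        refine Real.rpow_le_rpow_of_exponent_le hN ?_
        have : K * (1 - β) ≤ K * τ := by gcongr; linarith
        linarith
      have : (c3 * (N : ℝ) ^ (-ε)) * (N : ℝ) ^ η ≤ Lr * (N : ℝ) ^ η := by
        refine le_trans ?_ key
        rw [mul_assoc]
        gcongr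
      have h4 := le_of_mul_le_mul_right this hNp
      refine le_trans ?_ h4
      gcongr
      exact min_le_right _ _
  · push Not at hex
    refine ⟨c0 * τ * 8 ^ (-(K * τ)), by positivity, ?_⟩
    intro N _ χ hp hq hχ δ hδ hδ1
    have hN : (1 : ℝ) ≤ N := by exact_mod_cast NeZero.pos N
    have dχ := DirichletCharacter.differentiable_LFunction hχ
    have h := hest (fun s => DirichletCharacter.LFunction χ (s + δ)) (8 * N) (by fun_prop)
      (by linarith) (fun s hs => LFunction_ball_bound χ hχ hδ hδ1 hs) (altA χ hχ hq hδ)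
      (two_ge_A χ hδ) (1 - τ) (by linarith) (by linarith) ?_
    · refine le_trans ?_ h
      rw [sub_sub_cancel, Real.mul_rpow (by norm_num) (by linarith), ← mul_assoc]
      gcongr
      linarith
    · have hzr := hzeta (1 - τ) (by linarith) (by linarith)
      have hpos : 0 < (DirichletCharacter.LFunction χ ((1 - τ + δ : ℝ) : ℂ)).re := by
        refine LFunction_pos_of_no_zero χ hχ hq (by linarith) fun x hx1 hx2 => ?_
        rcases lt_or_ge x 1 with hx | hx
        · exact hex N inferInstance χ hp hq hχ x (by linarith) hx
        · exact DirichletCharacter.LFunction_ne_zero_of_one_le_re χ (Or.inl hχ) (by simpa using hx)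
      have e : (((1 - τ : ℝ) : ℂ)) + δ = ((1 - τ + δ : ℝ) : ℂ) := by push_cast; ring
      simp only [e]
      rw [LFunction_eq_re χ hχ hq (x := 1 - τ + δ) (by linarith), re_mul_ofReal]
      nlinarith

lemma zeta_re_ge {x : ℝ} (hx : 1 < x) : 1 ≤ (riemannZeta x).re := by
  have hs : 1 < (x : ℂ).re := by simpa using hx
  have h := hasSum_re (LSeriesSummable_one_iff.2 hs).hasSum
  rw [← LSeries_one_eq_riemannZeta hs]
  have := h.summable.le_tsum 1 (fun n _ => ?_)
  · rw [h.tsum_eq] at this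
    simpa [LSeries] using this
  · have := LSeries.term_nonneg (a := (1 : ℕ → ℂ)) (n := n) (by simp) x
    exact (Complex.nonneg_iff.1 this).1

lemma siegel_all (ε : ℝ) (hε : 0 < ε) : ∃ c > 0, ∀ (N : ℕ) [NeZero N]
    (χ : DirichletCharacter ℂ N), χ.IsPrimitive → χ ^ 2 = 1 → ∀ δ : ℝ, 0 < δ → δ ≤ 1 →
      c * (N : ℝ) ^ (-ε) ≤ (DirichletCharacter.LFunction χ (1 + δ)).re := by
  obtain ⟨c, hc, h⟩ := siegel_nontriv ε hε
  refine ⟨min c 1, by positivity, ?_⟩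
  intro N _ χ hp hq δ hδ hδ1
  by_cases hχ : χ = 1
  · have hN : N = 1 := by
      rw [hχ] at hp
      rw [DirichletCharacter.IsPrimitive, DirichletCharacter.conductor_one] at hp
      exact hp.symm
    subst hN
    rw [DirichletCharacter.LFunction_modOne_eq]
    have h1 := zeta_re_ge (x := 1 + δ) (by linarith)
    push_cast at h1
    simp only [Nat.cast_one, Real.one_rpow, mul_one]
    exact (min_le_right _ _).trans h1
  · refine le_trans ?_ (h N χ hp hq hχ δ hδ.le hδ1)
    gcongr
    exact min_le_left _ _

end Siegel
end

/-- Siegel's theorem at `s = 1 + 1/log X`: for every `ε > 0` there is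
`c(ε) > 0` such that for every real primitive Dirichlet character `χ = χ_d` of
fundamental discriminant `d` (the real primitive character modulo `|d|` with
`χ(-1) = sign d`) and every `X ≥ 3`, `L(1 + 1/log X, χ) ≥ c(ε)·|d|^{-ε}`. -/
theorem stmt18 (ε : ℝ) (hε : 0 < ε) :
    ∃ c > 0, ∀ d : ℤ, ∀ hd0 : d ≠ 0, IsFundamentalDiscriminant d →
      ∀ χ : DirichletCharacter ℂ d.natAbs, χ.IsPrimitive → χ ^ 2 = 1 →
      χ (-1) = (if d < 0 then -1 else 1) →
      ∀ X : ℝ, 3 ≤ X →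
        c * |(d : ℝ)| ^ (-ε) ≤
          (@DirichletCharacter.LFunction d.natAbs ⟨Int.natAbs_ne_zero.mpr hd0⟩ χ
            (1 + 1 / Real.log X)).re := by
  obtain ⟨c, hc, h⟩ := Siegel.siegel_all ε hε
  refine ⟨c, hc, ?_⟩
  intro d hd0 _ χ hp hq _ X hX
  have : NeZero d.natAbs := ⟨Int.natAbs_ne_zero.mpr hd0⟩
  have habs : |(d : ℝ)| = (d.natAbs : ℝ) := by rw [Nat.cast_natAbs]; push_cast; rfl
  have hlog : 1 ≤ Real.log X := by
    rw [Real.le_log_iff_exp_le (by linarith)]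
    linarith [Real.exp_one_lt_d9]
  have h1 := h d.natAbs χ hp hq (1 / Real.log X) (by positivity)
    (by rw [div_le_one (by linarith)]; exact hlog)
  rw [habs]
  push_cast at h1
  exact h1
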